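/- arXiv:2203.05905 — 2 statements merged into one kernel-verified Lean document; each statement's English description precedes it below -/
import Mathlib

section
/- Assume (H1) and (H2) and let J be the operator defined in the context. Then J maps bounded sets onto equicontinuous sets: for every R > 0 and every ε > 0 there exists δ > 0 such that for every bounded y : [−r,τ] → ℝⁿ with ‖y‖ ≤ R and s ↦ f(s,y_s) Lebesgue integrable on [0,τ], every i ∈ {0,1,…,N}, and all ν₁, ν₂ with sᵢ < ν₁ ≤ ν₂ ≤ t_{i+1} and ν₂ − ν₁ < δ, one has ‖J(y)(ν₂) − J(y)(ν₁)‖_{ℝⁿ} < ε. -/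
open Matrix MeasureTheory Set Filter

/-- supremum of the norm of `w` over the interval `[a, b]`. -/
noncomputable def supOn {E : Type*} [NormedAddCommGroup E]
    (a b : ℝ) (w : ℝ → E) : ℝ :=
  ⨆ u : Set.Icc a b, ‖w u.1‖

/-- `w` is bounded (in norm) on the interval `[a, b]`. -/
def BddOn {E : Type*} [NormedAddCommGroup E] (a b : ℝ) (w : ℝ → E) : Prop :=
  ∃ C : ℝ, ∀ u ∈ Set.Icc a b, ‖w u‖ ≤ C

/-- A bound for `‖w‖` on `[a, b]` bounds `supOn a b w`. -/
theorem supOn_le {E : Type*} [NormedAddCommGroup E] {a b R : ℝ} {w : ℝ → E} (hR : 0 ≤ R)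
    (h : ∀ u ∈ Set.Icc a b, ‖w u‖ ≤ R) : supOn a b w ≤ R :=
  Real.iSup_le (fun u => h u.1 u.2) hR

/-- Variation-of-constants integrals with factored kernel `P t ∘ Q s` are equicontinuous,
uniformly over bounded initial data and bounded integrable forcing terms. -/
theorem exists_delta_variation_of_constants {E : Type*} [NormedAddCommGroup E] [NormedSpace ℝ E]
    [CompleteSpace E] {P Q : ℝ → E →L[ℝ] E} (hP : Continuous P) (hQ : Continuous Q)
    {τ C B ε : ℝ} (hτ : 0 < τ) (hC : 0 ≤ C) (hB : 0 ≤ B) (hε : 0 < ε) :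
    ∃ δ : ℝ, 0 < δ ∧ ∀ (x : E) (F : ℝ → E) (a ν₁ ν₂ : ℝ), ‖x‖ ≤ C →
      (∀ v ∈ Set.Icc (0 : ℝ) τ, ‖F v‖ ≤ B) → IntervalIntegrable F volume 0 τ →
      0 ≤ a → a ≤ ν₁ → ν₁ ≤ ν₂ → ν₂ ≤ τ → ν₂ - ν₁ < δ →
      ‖(P ν₂ (Q a x) + ∫ v in a..ν₂, P ν₂ (Q v (F v)))
        - (P ν₁ (Q a x) + ∫ v in a..ν₁, P ν₁ (Q v (F v)))‖ < ε := by
  obtain ⟨p, hp⟩ := isCompact_Icc.exists_bound_of_continuousOn (s := Icc 0 τ) hP.continuousOn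
  obtain ⟨k, hk⟩ := isCompact_Icc.exists_bound_of_continuousOn (s := Icc 0 τ) hQ.continuousOn
  have h0 : (0 : ℝ) ∈ Icc 0 τ := ⟨le_rfl, hτ.le⟩
  have hp0 : 0 ≤ p := (norm_nonneg _).trans (hp 0 h0)
  have hk0 : 0 ≤ k := (norm_nonneg _).trans (hk 0 h0)
  set W : ℝ := k * C + k * B * τ with hW
  have hW0 : 0 ≤ W := by positivity
  have hu := Metric.uniformContinuousOn_iff.1
    ((isCompact_Icc (a := (0 : ℝ)) (b := τ)).uniformContinuousOn_of_continuous hP.continuousOn)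
    (ε / (2 * (W + 1))) (by positivity)
  obtain ⟨δ, hδ, hPδ⟩ := hu
  refine ⟨min δ (ε / (2 * (p * (k * B) + 1))), lt_min hδ (by positivity), ?_⟩
  intro x F a ν₁ ν₂ hx hF hFi ha h1 h12 h2 hν
  have hν₁ : ν₁ ∈ Icc 0 τ := ⟨ha.trans h1, h12.trans h2⟩
  have hν₂ : ν₂ ∈ Icc 0 τ := ⟨hν₁.1.trans h12, h2⟩
  have haI : a ∈ Icc 0 τ := ⟨ha, h1.trans hν₁.2⟩
  have hb : ∀ v ∈ Icc 0 τ, ‖Q v (F v)‖ ≤ k * B := fun v hv =>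
    (Q v).le_of_opNorm_le_of_le (hk v hv) (hF v hv)
  have hQF : IntervalIntegrable (fun v => Q v (F v)) volume 0 τ := by
    rw [intervalIntegrable_iff_integrableOn_Ioc_of_le hτ.le] at hFi ⊢
    refine Integrable.of_bound ?_ (k * B) ?_
    · exact isBoundedBilinearMap_apply.continuous.comp_aestronglyMeasurable₂
        hQ.aestronglyMeasurable hFi.aestronglyMeasurable
    · exact (ae_restrict_iff' measurableSet_Ioc).2
        (Filter.Eventually.of_forall fun v hv => hb v ⟨hv.1.le, hv.2⟩)
  have hint : ∀ c ∈ Icc 0 τ, ∀ d ∈ Icc 0 τ,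
      IntervalIntegrable (fun v => Q v (F v)) volume c d := fun c hc d hd =>
    hQF.mono_set (by rw [uIcc_of_le hτ.le]; exact uIcc_subset_Icc hc hd)
  have hbd : ∀ c ∈ Icc 0 τ, ∀ d ∈ Icc 0 τ, c ≤ d →
      ‖∫ v in c..d, Q v (F v)‖ ≤ k * B * (d - c) := by
    intro c hc d hd hcd
    have := intervalIntegral.norm_integral_le_of_norm_le_const (a := c) (b := d) (C := k * B)
      (f := fun v => Q v (F v)) (fun v hv => hb v (by
        rw [uIoc_of_le hcd] at hv
        exact ⟨hc.1.trans hv.1.le, hv.2.trans hd.2⟩))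
    rwa [abs_of_nonneg (sub_nonneg.2 hcd)] at this
  rw [(P ν₂).intervalIntegral_comp_comm (hint a haI ν₂ hν₂),
    (P ν₁).intervalIntegral_comp_comm (hint a haI ν₁ hν₁),
    ← intervalIntegral.integral_add_adjacent_intervals (hint a haI ν₁ hν₁) (hint ν₁ hν₁ ν₂ hν₂)]
  set I := ∫ v in a..ν₁, Q v (F v)
  set I' := ∫ v in ν₁..ν₂, Q v (F v)
  have hsplit : P ν₂ (Q a x) + P ν₂ (I + I') - (P ν₁ (Q a x) + P ν₁ I)
      = (P ν₂ - P ν₁) (Q a x + I) + P ν₂ I' := by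
    simp only [map_add, _root_.sub_apply]; abel
  have hw : ‖Q a x + I‖ ≤ W := by
    refine (norm_add_le _ _).trans (add_le_add ((Q a).le_of_opNorm_le_of_le (hk a haI) hx) ?_)
    refine (hbd a haI ν₁ hν₁ h1).trans ?_
    exact mul_le_mul_of_nonneg_left (by linarith [hν₁.2]) (by positivity)
  have hd : ‖P ν₂ - P ν₁‖ ≤ ε / (2 * (W + 1)) := by
    rw [← dist_eq_norm]
    refine (hPδ ν₂ hν₂ ν₁ hν₁ ?_).le
    rw [Real.dist_eq, abs_of_nonneg (sub_nonneg.2 h12)]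
    exact hν.trans_le (min_le_left _ _)
  have e1 : ‖(P ν₂ - P ν₁) (Q a x + I)‖ < ε / 2 := by
    refine (ContinuousLinearMap.le_of_opNorm_le_of_le _ hd hw).trans_lt ?_
    rw [div_mul_eq_mul_div, div_lt_div_iff₀ (by positivity) (by positivity)]
    nlinarith
  have e2 : ‖P ν₂ I'‖ ≤ ε / 2 := by
    refine ((P ν₂).le_of_opNorm_le_of_le (hp ν₂ hν₂) (hbd ν₁ hν₁ ν₂ hν₂ h12)).trans ?_
    have h3 : (ν₂ - ν₁) * (2 * (p * (k * B) + 1)) < ε :=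
      (lt_div_iff₀ (by positivity)).1 (hν.trans_le (min_le_right _ _))
    nlinarith
  rw [hsplit]
  linarith [norm_add_le ((P ν₂ - P ν₁) (Q a x + I)) (P ν₂ I')]

/-- The continuous linear map `x ↦ S *ᵥ x` depends continuously on the matrix `S`. -/
theorem continuous_toContinuousLinearMap_mulVecLin (n : ℕ) :
    Continuous fun S : Matrix (Fin n) (Fin n) ℝ =>
      LinearMap.toContinuousLinearMap S.mulVecLin :=
  (LinearMap.toContinuousLinearMap.toLinearMap.comp
    (Matrix.toLin' (R := ℝ) (m := Fin n) (n := Fin n)).toLinearMap).continuous_of_finiteDimensional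

/-- The inverse of a continuous family of invertible matrices is continuous. -/
theorem continuous_matrix_inv_of_isUnit {n : ℕ} {Φ : ℝ → Matrix (Fin n) (Fin n) ℝ}
    (hΦ : Continuous Φ) (h : ∀ t, IsUnit (Φ t)) : Continuous fun t => (Φ t)⁻¹ := by
  simp only [Matrix.inv_def, Ring.inverse_eq_inv']
  exact (hΦ.matrix_det.inv₀ fun t => ((Matrix.isUnit_iff_isUnit_det _).1 (h t)).ne_zero).smul
    hΦ.matrix_adjugate

/-- Under (H1) and (H2), the operator `J` maps bounded sets onto equicontinuous
sets: for every `R > 0` and `ε > 0` there is `δ > 0` such that for every `y`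
with `‖y‖ ≤ R` (and integrable superposition), every `i ∈ {0,…,N}` and all
`ν₁, ν₂` with `sᵢ < ν₁ ≤ ν₂ ≤ t_{i+1}` and `ν₂ − ν₁ < δ`, one has
`‖J(y)(ν₂) − J(y)(ν₁)‖ < ε`. -/
theorem J_maps_bounded_to_equicontinuous
    (n N q : ℕ) (hn : 1 ≤ n)
    (r τ : ℝ) (hr : 0 < r) (hτ : 0 < τ)
    (tt ss : ℕ → ℝ) (htt0 : tt 0 = 0) (hss0 : ss 0 = 0) (htt1 : 0 < tt 1)
    (hts : ∀ i ∈ Finset.Icc 1 N, tt i ≤ ss i ∧ ss i < tt (i + 1))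
    (httN : tt (N + 1) = τ)
    (θ : ℕ → ℝ) (hθ : ∀ j ∈ Finset.Icc 1 q, 0 < θ j ∧ θ j < τ)
    (hθmono : ∀ j ∈ Finset.Icc 1 (q - 1), θ j < θ (j + 1))
    (A : ℝ → Matrix (Fin n) (Fin n) ℝ) (hA : Continuous A)
    (Φ : ℝ → Matrix (Fin n) (Fin n) ℝ)
    (hΦderiv : ∀ t : ℝ, ∀ i j : Fin n,
      HasDerivAt (fun u => Φ u i j) ((A t * Φ t) i j) t)
    (hΦ0 : Φ 0 = 1) (hΦinv : ∀ t, IsUnit (Φ t))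
    (U : ℝ → ℝ → Matrix (Fin n) (Fin n) ℝ)
    (hU : ∀ t s : ℝ, U t s = Φ t * (Φ s)⁻¹)
    (M : ℝ) (hM : 1 ≤ M)
    (hUbd : ∀ t s : ℝ, 0 ≤ s → s ≤ t → t ≤ τ →
      ∀ x : Fin n → ℝ, ‖U t s *ᵥ x‖ ≤ M * ‖x‖)
    -- (H1)
    (Nq L : ℝ) (hNq : 0 < Nq) (hL : 0 < L) (hNqL : L + Nq * (q : ℝ) < 1 / 2)
    (g : (Fin q → ℝ → (Fin n → ℝ)) → ℝ → (Fin n → ℝ))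
    (hg0 : g (fun _ _ => 0) = fun _ => 0)
    (hglip : ∀ y z : Fin q → ℝ → (Fin n → ℝ), ∀ u ∈ Set.Icc (-r) (0 : ℝ),
      ‖g y u - g z u‖ ≤ Nq * ∑ j : Fin q, ‖y j u - z j u‖)
    (G : ℕ → ℝ → (Fin n → ℝ) → (Fin n → ℝ))
    (hG0 : ∀ i ∈ Finset.Icc 1 N, ∀ u : ℝ, G i u 0 = 0)
    (hGlip : ∀ i ∈ Finset.Icc 1 N, ∀ (u : ℝ) (x y : Fin n → ℝ),
      ‖G i u x - G i u y‖ ≤ L * ‖x - y‖)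
    -- (H2)
    (f : ℝ → (ℝ → (Fin n → ℝ)) → (Fin n → ℝ))
    (K : ℝ → ℝ → ℝ) (Ψ : ℝ → ℝ)
    (hKcont : Continuous fun p : ℝ × ℝ => K p.1 p.2)
    (hKmono : ∀ a a' b b' : ℝ, a ≤ a' → b ≤ b' → K a b ≤ K a' b')
    (hKnonneg : ∀ a b : ℝ, 0 ≤ K a b)
    (hΨcont : Continuous Ψ) (hΨmono : Monotone Ψ) (hΨnonneg : ∀ a : ℝ, 0 ≤ Ψ a)
    (hflip : ∀ u ∈ Set.Icc (0 : ℝ) τ, ∀ φ₁ φ₂ : ℝ → (Fin n → ℝ),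
      BddOn (-r) 0 φ₁ → BddOn (-r) 0 φ₂ →
      ‖f u φ₁ - f u φ₂‖ ≤ K (supOn (-r) 0 φ₁) (supOn (-r) 0 φ₂) * supOn (-r) 0 (φ₁ - φ₂))
    (hfbd : ∀ u ∈ Set.Icc (0 : ℝ) τ, ∀ φ' : ℝ → (Fin n → ℝ),
      BddOn (-r) 0 φ' → ‖f u φ'‖ ≤ Ψ (supOn (-r) 0 φ'))
    -- data for J
    (φ : ℝ → (Fin n → ℝ)) (hφ : BddOn (-r) 0 φ) (η : Fin n → ℝ) :
    ∀ R : ℝ, 0 < R → ∀ ε : ℝ, 0 < ε → ∃ δ : ℝ, 0 < δ ∧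
      ∀ y Jy : ℝ → (Fin n → ℝ),
        (∀ u ∈ Set.Icc (-r) τ, ‖y u‖ ≤ R) →
        IntervalIntegrable (fun u => f u (fun v => y (u + v))) volume 0 τ →
        (∀ u ∈ Set.Ioc (0 : ℝ) (tt 1), Jy u =
          U u 0 *ᵥ (φ 0 - g (fun j w => y (θ (j.1 + 1) + w)) 0)
            + ∫ v in (0 : ℝ)..u, U u v *ᵥ f v (fun w => y (v + w))) →
        (∀ i ∈ Finset.Icc 1 N, ∀ u ∈ Set.Ioc (ss i) (tt (i + 1)), Jy u =
          U u (ss i) *ᵥ G i (ss i) (y (ss i))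
            + ∫ v in (ss i)..u, U u v *ᵥ f v (fun w => y (v + w))) →
        (∀ i ∈ Finset.Icc 1 N, ∀ u ∈ Set.Ioc (tt i) (ss i), Jy u = η) →
        (∀ u ∈ Set.Icc (-r) (0 : ℝ), Jy u = φ u) →
        ∀ i ∈ Finset.Icc 0 N, ∀ ν₁ ν₂ : ℝ,
          ss i < ν₁ → ν₁ ≤ ν₂ → ν₂ ≤ tt (i + 1) → ν₂ - ν₁ < δ →
          ‖Jy ν₂ - Jy ν₁‖ < ε := by
  have hΦc : Continuous Φ := continuous_matrix fun i j =>
    continuous_iff_continuousAt.2 fun t => (hΦderiv t i j).continuousAt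
  intro R hR ε hε
  set C : ℝ := max (‖φ 0‖ + Nq * (q * R)) (L * R) with hC
  have hC0 : 0 ≤ C := (by positivity : 0 ≤ L * R).trans (le_max_right _ _)
  obtain ⟨δ, hδ, H⟩ := exists_delta_variation_of_constants
    ((continuous_toContinuousLinearMap_mulVecLin n).comp hΦc)
    ((continuous_toContinuousLinearMap_mulVecLin n).comp
      (continuous_matrix_inv_of_isUnit hΦc hΦinv)) hτ hC0 (hΨnonneg R) hε
  refine ⟨δ, hδ, ?_⟩
  intro y Jy hy hint hJ0 hJ _ _ i hi ν₁ ν₂ h1 h12 h2 hν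
  have htpos : ∀ m, m ≤ N → 0 < tt (m + 1) := by
    intro m
    induction m with
    | zero => intro _; simpa using htt1
    | succ m ih =>
      intro hm
      have h := hts (m + 1) (Finset.mem_Icc.2 ⟨by omega, hm⟩)
      linarith [ih (by omega)]
  have htle : ∀ m, m ≤ N → tt (N - m + 1) ≤ τ := by
    intro m
    induction m with
    | zero => intro _; simp [httN]
    | succ m ih =>
      intro hm
      have h := hts (N - m) (Finset.mem_Icc.2 ⟨by omega, by omega⟩)
      have h' : N - (m + 1) + 1 = N - m := by omega
      rw [h']
      linarith [ih (by omega)]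
  have hiN : i ≤ N := (Finset.mem_Icc.1 hi).2
  have hti : tt (i + 1) ≤ τ := by
    have h := htle (N - i) (by omega)
    rwa [Nat.sub_sub_self hiN] at h
  have hF : ∀ v ∈ Icc (0 : ℝ) τ, ‖f v (fun w => y (v + w))‖ ≤ Ψ R := by
    intro v hv
    have hyv : ∀ u ∈ Icc (-r) 0, ‖y (v + u)‖ ≤ R := fun u hu =>
      hy _ ⟨by linarith [hv.1, hu.1], by linarith [hv.2, hu.2]⟩
    exact (hfbd v hv _ ⟨R, hyv⟩).trans (hΨmono (supOn_le hR.le hyv))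
  have key : ∃ x : Fin n → ℝ, ‖x‖ ≤ C ∧ 0 ≤ ss i ∧ ∀ u ∈ Ioc (ss i) (tt (i + 1)),
      Jy u = U u (ss i) *ᵥ x + ∫ v in (ss i)..u, U u v *ᵥ f v (fun w => y (v + w)) := by
    rcases Nat.eq_zero_or_pos i with rfl | hipos
    · refine ⟨φ 0 - g (fun j w => y (θ (j.1 + 1) + w)) 0, ?_, hss0.ge, ?_⟩
      · refine le_trans ?_ (le_max_left _ _)
        refine (norm_sub_le _ _).trans (add_le_add le_rfl ?_)
        have h := hglip (fun j w => y (θ (j.1 + 1) + w)) (fun _ _ => 0) 0 ⟨by linarith, le_rfl⟩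
        rw [hg0] at h
        simp only [sub_zero, add_zero] at h
        refine h.trans (mul_le_mul_of_nonneg_left ?_ hNq.le)
        refine (Finset.sum_le_card_nsmul _ _ R fun j _ => ?_).trans (by simp)
        have hj := hθ (j.1 + 1) (Finset.mem_Icc.2 ⟨by omega, j.2⟩)
        exact hy _ ⟨by linarith, hj.2.le⟩
      · simpa only [hss0, zero_add] using hJ0
    · have hi' : i ∈ Finset.Icc 1 N := Finset.mem_Icc.2 ⟨hipos, hiN⟩
      have hsi : 0 ≤ ss i := by
        have h := htpos (i - 1) (by omega)
        rw [Nat.sub_add_cancel hipos] at h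
        linarith [(hts i hi').1]
      refine ⟨G i (ss i) (y (ss i)), ?_, hsi, hJ i hi'⟩
      refine le_trans ?_ (le_max_right _ _)
      have h := hGlip i hi' (ss i) (y (ss i)) 0
      rw [hG0 i hi', sub_zero, sub_zero] at h
      exact h.trans (mul_le_mul_of_nonneg_left
        (hy _ ⟨by linarith, by linarith [(hts i hi').2]⟩) hL.le)
  obtain ⟨x, hx, hs, hJx⟩ := key
  have h := H x (fun v => f v (fun w => y (v + w))) (ss i) ν₁ ν₂ hx hF hint hs h1.le h12
    (h2.trans hti) hν
  rw [hJx ν₂ ⟨h1.trans_le h12, h2⟩, hJx ν₁ ⟨h1, h12.trans h2⟩]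
  simpa [hU, Matrix.mulVec_mulVec] using h
end

section
/- Assume (H1) and (H2) and let J be the operator defined in the context. Then J is a compact operator in the following sense: for every R > 0 and every sequence (yₙ) of bounded functions yₙ : [−r,τ] → ℝⁿ with ‖yₙ‖ ≤ R and s ↦ f(s,(yₙ)_s) Lebesgue integrable on [0,τ] for each n, there exists a subsequence (y_{n_k}) such that the sequence of functions (J(y_{n_k})) converges uniformly on [−r,τ] to some function w : [−r,τ] → ℝⁿ. -/
open Matrix MeasureTheory Set Filter

/-- A sequence of functions on `[a, b]` that are uniformly Lipschitz and vanish at `a` has a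
uniformly Cauchy subsequence. -/
theorem exists_subseq_uniformCauchySeqOn_Icc {E : Type*} [NormedAddCommGroup E] [ProperSpace E]
    {a b C : ℝ} (hab : a ≤ b) (h : ℕ → ℝ → E) (h_zero : ∀ k, h k a = 0)
    (h_lip : ∀ k, ∀ u ∈ Icc a b, ∀ v ∈ Icc a b, ‖h k u - h k v‖ ≤ C * |u - v|) :
    ∃ σ : ℕ → ℕ, StrictMono σ ∧
      UniformCauchySeqOn (fun k => h (σ k)) atTop (Icc a b) := by
  have hlip (k : ℕ) : LipschitzWith C.toNNReal (fun u : Icc a b => h k u) := by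
    refine LipschitzWith.of_dist_le_mul fun u v => ?_
    rw [dist_eq_norm, Subtype.dist_eq, Real.dist_eq]
    exact (h_lip k u u.2 v v.2).trans
      (mul_le_mul_of_nonneg_right (Real.le_coe_toNNReal C) (abs_nonneg _))
  let F (k : ℕ) : BoundedContinuousFunction (Icc a b) E :=
    BoundedContinuousFunction.mkOfCompact ⟨fun u => h k u, (hlip k).continuous⟩
  have hcompact : IsCompact (closure (range F)) := by
    refine BoundedContinuousFunction.arzela_ascoli (Metric.closedBall (0 : E) (|C| * (b - a)))
      (isCompact_closedBall _ _) (range F) ?_ ?_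
    · rintro _ u ⟨k, rfl⟩
      have h₁ := h_lip k u u.2 a ⟨le_rfl, hab⟩
      rw [h_zero, sub_zero] at h₁
      rw [mem_closedBall_zero_iff]
      refine h₁.trans (mul_le_mul (le_abs_self C) ?_ (abs_nonneg _) (abs_nonneg C))
      rw [abs_of_nonneg (sub_nonneg.2 u.2.1)]
      exact sub_le_sub_right u.2.2 a
    · refine (LipschitzWith.uniformEquicontinuous _ C.toNNReal ?_).equicontinuous
      rintro ⟨_, k, rfl⟩
      exact hlip k
  obtain ⟨_, -, σ, hσ, hlim⟩ :=
    hcompact.tendsto_subseq (x := F) fun k => subset_closure (mem_range_self k)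
  refine ⟨σ, hσ, Metric.uniformCauchySeqOn_iff.2 fun ε hε => ?_⟩
  obtain ⟨m, hm⟩ := Metric.cauchySeq_iff.1 hlim.cauchySeq ε hε
  exact ⟨m, fun k hk l hl u hu =>
    (BoundedContinuousFunction.dist_coe_le_dist (f := F (σ k)) (g := F (σ l)) ⟨u, hu⟩).trans_lt
      (hm k hk l hl)⟩

/-- A uniformly Cauchy sequence with values in a complete space converges uniformly. -/
theorem UniformCauchySeqOn.exists_tendstoUniformlyOn {α E : Type*} [UniformSpace E]
    [CompleteSpace E] [Nonempty E] {F : ℕ → α → E} {s : Set α}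
    (hF : UniformCauchySeqOn F atTop s) : ∃ w : α → E, TendstoUniformlyOn F w atTop s := by
  have hlim (u : α) : ∃ x, u ∈ s → Tendsto (fun k => F k u) atTop (nhds x) := by
    by_cases hu : u ∈ s
    · obtain ⟨x, hx⟩ := cauchySeq_tendsto_of_complete (hF.cauchySeq hu)
      exact ⟨x, fun _ => hx⟩
    · exact ⟨Classical.arbitrary E, fun h => absurd h hu⟩
  choose w hw using hlim
  exact ⟨w, hF.tendstoUniformlyOn_of_tendsto hw⟩

/-- A continuous family of matrices is uniformly bounded on a compact interval. -/
theorem exists_norm_mulVec_le_of_continuous {m : Type*} [Fintype m]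
    {B : ℝ → Matrix m m ℝ} (hB : Continuous B) (a b ρ : ℝ) :
    ∃ C, ∀ v ∈ Icc a b, ∀ x : m → ℝ, ‖x‖ ≤ ρ → ‖B v *ᵥ x‖ ≤ C := by
  have hcont : Continuous fun p : ℝ × (m → ℝ) => B p.1 *ᵥ p.2 :=
    (hB.comp continuous_fst).matrix_mulVec continuous_snd
  obtain ⟨C, hC⟩ := IsCompact.exists_bound_of_continuousOn
    (isCompact_Icc.prod (isCompact_closedBall (0 : m → ℝ) ρ)) hcont.continuousOn
  exact ⟨C, fun v hv x hx => hC (v, x) ⟨hv, mem_closedBall_zero_iff.2 hx⟩⟩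

/-- Multiplying by a continuous family of matrices preserves interval integrability. -/
theorem IntervalIntegrable.continuous_mulVec {m : Type*} [Fintype m]
    {B : ℝ → Matrix m m ℝ} (hB : Continuous B) {F : ℝ → m → ℝ} {a b : ℝ}
    (hF : IntervalIntegrable F volume a b) :
    IntervalIntegrable (fun v => B v *ᵥ F v) volume a b := by
  have hF' (j : m) : IntervalIntegrable (fun v => F v j) volume a b :=
    ⟨hF.1.eval j, hF.2.eval j⟩
  have hcoord (i : m) : IntervalIntegrable (fun v => (B v *ᵥ F v) i) volume a b := by
    have h := IntervalIntegrable.sum Finset.univ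
      fun j _ => (hF' j).continuousOn_mul (hB.matrix_elem i j).continuousOn
    have hsum : (fun v => (B v *ᵥ F v) i) = ∑ j, fun v => B v i j * F v j := by
      ext v
      simp [Matrix.mulVec, dotProduct]
    rwa [hsum]
  exact ⟨Integrable.of_eval fun i => (hcoord i).1, Integrable.of_eval fun i => (hcoord i).2⟩

/-- A constant matrix can be pulled out of an interval integral. -/
theorem intervalIntegral_mulVec_const {m : Type*} [Fintype m]
    (B : Matrix m m ℝ) {F : ℝ → m → ℝ} {a b : ℝ} (hF : IntervalIntegrable F volume a b) :
    ∫ v in a..b, B *ᵥ F v = B *ᵥ ∫ v in a..b, F v :=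
  (LinearMap.toContinuousLinearMap B.mulVecLin).intervalIntegral_comp_comm hF

/-- The inverse of a continuous family of invertible matrices is continuous. -/
theorem continuous_matrix_inv {m : Type*} [Fintype m] [DecidableEq m]
    {B : ℝ → Matrix m m ℝ} (hB : Continuous B) (hinv : ∀ t, IsUnit (B t)) :
    Continuous fun t => (B t)⁻¹ := by
  have hdet (t : ℝ) : (B t).det ≠ 0 := ((Matrix.isUnit_iff_isUnit_det _).1 (hinv t)).ne_zero
  simp only [Matrix.inv_def, Ring.inverse_eq_inv']
  exact (hB.matrix_det.inv₀ hdet).smul hB.matrix_adjugate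

/-- A point of `(tt 0, tt m]` lies in one of the intervals `(tt i, tt (i + 1)]`. -/
theorem exists_mem_Ioc_succ {tt : ℕ → ℝ} {u : ℝ} (hu : tt 0 < u) :
    ∀ m, u ≤ tt m → ∃ i < m, u ∈ Ioc (tt i) (tt (i + 1))
  | 0, h => absurd hu h.not_gt
  | m + 1, h => by
    rcases le_or_gt u (tt m) with h' | h'
    · obtain ⟨i, hi, hui⟩ := exists_mem_Ioc_succ hu m h'
      exact ⟨i, hi.trans m.lt_succ_self, hui⟩
    · exact ⟨m, m.lt_succ_self, h', h⟩

/-- Under (H1) and (H2), the operator `J` is compact: for every sequence of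
functions `yₖ` bounded by `R` (with integrable superpositions), the sequence
`J(yₖ)` has a subsequence converging uniformly on `[−r,τ]`. -/
theorem J_is_compact_operator
    (n N q : ℕ) (hn : 1 ≤ n)
    (r τ : ℝ) (hr : 0 < r) (hτ : 0 < τ)
    (tt ss : ℕ → ℝ) (htt0 : tt 0 = 0) (hss0 : ss 0 = 0) (htt1 : 0 < tt 1)
    (hts : ∀ i ∈ Finset.Icc 1 N, tt i ≤ ss i ∧ ss i < tt (i + 1))
    (httN : tt (N + 1) = τ)
    (θ : ℕ → ℝ) (hθ : ∀ j ∈ Finset.Icc 1 q, 0 < θ j ∧ θ j < τ)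
    (hθmono : ∀ j ∈ Finset.Icc 1 (q - 1), θ j < θ (j + 1))
    (A : ℝ → Matrix (Fin n) (Fin n) ℝ) (hA : Continuous A)
    (Φ : ℝ → Matrix (Fin n) (Fin n) ℝ)
    (hΦderiv : ∀ t : ℝ, ∀ i j : Fin n,
      HasDerivAt (fun u => Φ u i j) ((A t * Φ t) i j) t)
    (hΦ0 : Φ 0 = 1) (hΦinv : ∀ t, IsUnit (Φ t))
    (U : ℝ → ℝ → Matrix (Fin n) (Fin n) ℝ)
    (hU : ∀ t s : ℝ, U t s = Φ t * (Φ s)⁻¹)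
    (M : ℝ) (hM : 1 ≤ M)
    (hUbd : ∀ t s : ℝ, 0 ≤ s → s ≤ t → t ≤ τ →
      ∀ x : Fin n → ℝ, ‖U t s *ᵥ x‖ ≤ M * ‖x‖)
    -- (H1)
    (Nq L : ℝ) (hNq : 0 < Nq) (hL : 0 < L) (hNqL : L + Nq * (q : ℝ) < 1 / 2)
    (g : (Fin q → ℝ → (Fin n → ℝ)) → ℝ → (Fin n → ℝ))
    (hg0 : g (fun _ _ => 0) = fun _ => 0)
    (hglip : ∀ y z : Fin q → ℝ → (Fin n → ℝ), ∀ u ∈ Set.Icc (-r) (0 : ℝ),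
      ‖g y u - g z u‖ ≤ Nq * ∑ j : Fin q, ‖y j u - z j u‖)
    (G : ℕ → ℝ → (Fin n → ℝ) → (Fin n → ℝ))
    (hG0 : ∀ i ∈ Finset.Icc 1 N, ∀ u : ℝ, G i u 0 = 0)
    (hGlip : ∀ i ∈ Finset.Icc 1 N, ∀ (u : ℝ) (x y : Fin n → ℝ),
      ‖G i u x - G i u y‖ ≤ L * ‖x - y‖)
    -- (H2)
    (f : ℝ → (ℝ → (Fin n → ℝ)) → (Fin n → ℝ))
    (K : ℝ → ℝ → ℝ) (Ψ : ℝ → ℝ)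
    (hKcont : Continuous fun p : ℝ × ℝ => K p.1 p.2)
    (hKmono : ∀ a a' b b' : ℝ, a ≤ a' → b ≤ b' → K a b ≤ K a' b')
    (hKnonneg : ∀ a b : ℝ, 0 ≤ K a b)
    (hΨcont : Continuous Ψ) (hΨmono : Monotone Ψ) (hΨnonneg : ∀ a : ℝ, 0 ≤ Ψ a)
    (hflip : ∀ u ∈ Set.Icc (0 : ℝ) τ, ∀ φ₁ φ₂ : ℝ → (Fin n → ℝ),
      BddOn (-r) 0 φ₁ → BddOn (-r) 0 φ₂ →
      ‖f u φ₁ - f u φ₂‖ ≤ K (supOn (-r) 0 φ₁) (supOn (-r) 0 φ₂) * supOn (-r) 0 (φ₁ - φ₂))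
    (hfbd : ∀ u ∈ Set.Icc (0 : ℝ) τ, ∀ φ' : ℝ → (Fin n → ℝ),
      BddOn (-r) 0 φ' → ‖f u φ'‖ ≤ Ψ (supOn (-r) 0 φ'))
    -- data for J
    (φ : ℝ → (Fin n → ℝ)) (hφ : BddOn (-r) 0 φ) (η : Fin n → ℝ)
    -- a bounded sequence of inputs
    (R : ℝ) (hR : 0 < R)
    (y : ℕ → ℝ → (Fin n → ℝ))
    (hyR : ∀ k : ℕ, ∀ u ∈ Set.Icc (-r) τ, ‖y k u‖ ≤ R)
    (hfy : ∀ k : ℕ,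
      IntervalIntegrable (fun u => f u (fun v => y k (u + v))) volume 0 τ)
    -- the sequence `J(yₖ)`, each term characterized by the defining equations
    (Jy : ℕ → ℝ → (Fin n → ℝ))
    (hJy1 : ∀ k : ℕ, ∀ u ∈ Set.Ioc (0 : ℝ) (tt 1), Jy k u =
      U u 0 *ᵥ (φ 0 - g (fun j w => y k (θ (j.1 + 1) + w)) 0)
        + ∫ v in (0 : ℝ)..u, U u v *ᵥ f v (fun w => y k (v + w)))
    (hJy2 : ∀ k : ℕ, ∀ i ∈ Finset.Icc 1 N, ∀ u ∈ Set.Ioc (ss i) (tt (i + 1)),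
      Jy k u = U u (ss i) *ᵥ G i (ss i) (y k (ss i))
        + ∫ v in (ss i)..u, U u v *ᵥ f v (fun w => y k (v + w)))
    (hJy3 : ∀ k : ℕ, ∀ i ∈ Finset.Icc 1 N, ∀ u ∈ Set.Ioc (tt i) (ss i),
      Jy k u = η)
    (hJy4 : ∀ k : ℕ, ∀ u ∈ Set.Icc (-r) (0 : ℝ), Jy k u = φ u) :
    ∃ σ : ℕ → ℕ, StrictMono σ ∧ ∃ w : ℝ → (Fin n → ℝ),
      TendstoUniformlyOn (fun k => Jy (σ k)) w Filter.atTop (Set.Icc (-r) τ) := by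
  have htt_lt : ∀ i ≤ N, tt i < tt (i + 1) := by
    intro i hi
    rcases Nat.eq_zero_or_pos i with rfl | hpos
    · simpa [htt0] using htt1
    · obtain ⟨h₁, h₂⟩ := hts i (Finset.mem_Icc.2 ⟨hpos, hi⟩)
      exact h₁.trans_lt h₂
  have htt_nonneg : ∀ i ≤ N + 1, 0 ≤ tt i := by
    intro i
    induction i with
    | zero => exact fun _ => htt0.ge
    | succ i ih => exact fun hi => (ih (by omega)).trans (htt_lt i (by omega)).le
  have htt_le : ∀ i ≤ N + 1, tt i ≤ τ := by
    intro i hi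
    induction hi using Nat.decreasingInduction with
    | self => exact httN.le
    | of_succ i hi ih => exact (htt_lt i (by omega)).le.trans ih
  have hss : ∀ i ∈ Finset.Icc 1 N, ss i ∈ Icc 0 τ := by
    intro i hi
    obtain ⟨h₁, h₂⟩ := hts i hi
    have hi' := Finset.mem_Icc.1 hi
    exact ⟨(htt_nonneg i (by omega)).trans h₁, h₂.le.trans (htt_le (i + 1) (by omega))⟩
  have hΦ : Continuous Φ :=
    continuous_matrix fun i j =>
      continuous_iff_continuousAt.2 fun t => (hΦderiv t i j).continuousAt
  have hΦi : Continuous fun t => (Φ t)⁻¹ := continuous_matrix_inv hΦ hΦinv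
  have hΦbd : ∀ u ∈ Icc (0 : ℝ) τ, ∀ x : Fin n → ℝ, ‖Φ u *ᵥ x‖ ≤ M * ‖x‖ := by
    intro u hu x
    have h := hUbd u 0 le_rfl hu.1 hu.2 x
    rwa [hU, hΦ0, inv_one, mul_one] at h
  let F : ℕ → ℝ → Fin n → ℝ := fun k v => f v fun w => y k (v + w)
  have hF_le : ∀ k, ∀ v ∈ Icc (0 : ℝ) τ, ‖F k v‖ ≤ Ψ R := by
    intro k v hv
    have hy : ∀ w ∈ Icc (-r) (0 : ℝ), ‖y k (v + w)‖ ≤ R := fun w hw =>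
      hyR k _ ⟨by linarith [hv.1, hw.1], by linarith [hv.2, hw.2]⟩
    refine (hfbd v hv _ ⟨R, hy⟩).trans (hΨmono ?_)
    have : Nonempty (Icc (-r) (0 : ℝ)) := ⟨⟨0, by linarith, le_rfl⟩⟩
    exact ciSup_le fun w => hy w w.2
  obtain ⟨C, hC⟩ := exists_norm_mulVec_le_of_continuous hΦi 0 τ (Ψ R)
  have hint : ∀ k, ∀ a ∈ Icc (0 : ℝ) τ, ∀ b ∈ Icc (0 : ℝ) τ,
      IntervalIntegrable (fun v => (Φ v)⁻¹ *ᵥ F k v) volume a b := by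
    intro k a ha b hb
    refine (IntervalIntegrable.continuous_mulVec hΦi (hfy k)).mono_set ?_
    rw [uIcc_of_le hτ.le]
    exact uIcc_subset_Icc ha hb
  let H : ℕ → ℝ → Fin n → ℝ := fun k u => ∫ v in (0 : ℝ)..u, (Φ v)⁻¹ *ᵥ F k v
  have h0 : (0 : ℝ) ∈ Icc 0 τ := ⟨le_rfl, hτ.le⟩
  have hH_sub : ∀ k, ∀ a ∈ Icc (0 : ℝ) τ, ∀ b ∈ Icc (0 : ℝ) τ,
      H k b - H k a = ∫ v in a..b, (Φ v)⁻¹ *ᵥ F k v := fun k a ha b hb =>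
    intervalIntegral.integral_interval_sub_left (hint k 0 h0 b hb) (hint k 0 h0 a ha)
  have hvar : ∀ k, ∀ a ∈ Icc (0 : ℝ) τ, ∀ b ∈ Icc (0 : ℝ) τ,
      ∫ v in a..b, U b v *ᵥ F k v = Φ b *ᵥ (H k b - H k a) := by
    intro k a ha b hb
    rw [hH_sub k a ha b hb, ← intervalIntegral_mulVec_const _ (hint k a ha b hb)]
    simp only [hU, Matrix.mulVec_mulVec]
  obtain ⟨σ, hσ, hHσ⟩ := exists_subseq_uniformCauchySeqOn_Icc hτ.le H
    (fun k => intervalIntegral.integral_same) (C := C) (by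
      intro k u hu v hv
      rw [hH_sub k v hv u hu]
      refine intervalIntegral.norm_integral_le_of_norm_le_const fun x hx => ?_
      have hx' : x ∈ Icc (0 : ℝ) τ := uIcc_subset_Icc hv hu (uIoc_subset_uIcc hx)
      exact hC x hx' _ (hF_le k x hx'))
  let c : ℕ → Fin (N + 1) → Fin n → ℝ := fun k i =>
    if i.1 = 0 then φ 0 - g (fun j w => y k (θ (j.1 + 1) + w)) 0
    else G i (ss i) (y k (ss i))
  have hg_le : ∀ k, ‖g (fun j w => y k (θ (j.1 + 1) + w)) 0‖ ≤ Nq * (q * R) := by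
    intro k
    have h := hglip (fun j w => y k (θ (j.1 + 1) + w)) (fun _ _ => 0) 0 ⟨by linarith, le_rfl⟩
    simp only [hg0, sub_zero, add_zero] at h
    refine h.trans (mul_le_mul_of_nonneg_left ?_ hNq.le)
    refine (Finset.sum_le_card_nsmul Finset.univ _ R fun j _ => ?_).trans (by simp)
    obtain ⟨h₁, h₂⟩ := hθ (j.1 + 1) (Finset.mem_Icc.2 ⟨by omega, j.2⟩)
    exact hyR k _ ⟨by linarith, h₂.le⟩
  have hc_le : ∀ k, c k ∈ Metric.closedBall (0 : Fin (N + 1) → Fin n → ℝ)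
      (max (‖φ 0‖ + Nq * (q * R)) (L * R)) := by
    intro k
    rw [mem_closedBall_zero_iff, pi_norm_le_iff_of_nonneg (le_max_of_le_right (by positivity))]
    intro i
    by_cases hi : i.1 = 0
    · simp only [c, if_pos hi]
      exact le_max_of_le_left ((norm_sub_le _ _).trans (by linarith [hg_le k]))
    · simp only [c, if_neg hi]
      have hi' : i.1 ∈ Finset.Icc 1 N := Finset.mem_Icc.2 ⟨by omega, by omega⟩
      have h := hGlip i hi' (ss i) (y k (ss i)) 0
      rw [hG0 i hi', sub_zero, sub_zero] at h
      obtain ⟨h₁, h₂⟩ := hss i hi'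
      exact le_max_of_le_right (h.trans
        (mul_le_mul_of_nonneg_left (hyR k _ ⟨by linarith, h₂⟩) hL.le))
  obtain ⟨_, -, ρ, hρ, hcρ⟩ := (isCompact_closedBall (0 : Fin (N + 1) → Fin n → ℝ)
    (max (‖φ 0‖ + Nq * (q * R)) (L * R))).tendsto_subseq (x := c ∘ σ) fun k => hc_le (σ k)
  refine ⟨σ ∘ ρ, hσ.comp hρ, UniformCauchySeqOn.exists_tendstoUniformlyOn ?_⟩
  -- On each piece, `J y` depends on `y` only through the initial vector and the function `H`.
  have hpiece : ∀ k l : ℕ, ∀ δ > 0, ‖c k - c l‖ < δ →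
      (∀ v ∈ Icc (0 : ℝ) τ, ‖H k v - H l v‖ < δ) → ∀ i : Fin (N + 1),
      ∀ s ∈ Icc (0 : ℝ) τ, ∀ u ∈ Icc s τ,
      (∀ k, Jy k u = U u s *ᵥ c k i + ∫ v in s..u, U u v *ᵥ F k v) →
      ‖Jy k u - Jy l u‖ ≤ M * (3 * δ) := by
    intro k l δ hδ hc hH i s hs u hu hJ
    have hu' : u ∈ Icc (0 : ℝ) τ := ⟨hs.1.trans hu.1, hu.2⟩
    have hsplit : Jy k u - Jy l u =
        U u s *ᵥ (c k i - c l i) + Φ u *ᵥ ((H k u - H l u) - (H k s - H l s)) := by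
      rw [hJ, hJ, hvar k s hs u hu', hvar l s hs u hu']
      simp only [Matrix.mulVec_sub]
      abel
    have hci : ‖c k i - c l i‖ < δ := (norm_le_pi_norm (c k - c l) i).trans_lt hc
    have hHus := norm_sub_le (H k u - H l u) (H k s - H l s)
    rw [hsplit]
    calc _ ≤ M * ‖c k i - c l i‖ + M * ‖(H k u - H l u) - (H k s - H l s)‖ :=
          (norm_add_le _ _).trans
            (add_le_add (hUbd u s hs.1 hu.1 hu.2 _) (hΦbd u hu' _))
      _ = M * (‖c k i - c l i‖ + ‖(H k u - H l u) - (H k s - H l s)‖) := by ring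
      _ ≤ M * (3 * δ) := mul_le_mul_of_nonneg_left
          (by linarith [hH u hu', hH s hs]) (by linarith)
  have hmain : ∀ k l : ℕ, ∀ δ > 0, ‖c k - c l‖ < δ →
      (∀ v ∈ Icc (0 : ℝ) τ, ‖H k v - H l v‖ < δ) →
      ∀ u ∈ Icc (-r) τ, ‖Jy k u - Jy l u‖ ≤ M * (3 * δ) := by
    intro k l δ hδ hc hH u hu
    have hnonneg : 0 ≤ M * (3 * δ) := by positivity
    rcases le_or_gt u 0 with hu0 | hu0
    · simpa [hJy4 k u ⟨hu.1, hu0⟩, hJy4 l u ⟨hu.1, hu0⟩] using hnonneg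
    obtain ⟨i, hi, hui⟩ := exists_mem_Ioc_succ (htt0.trans_lt hu0) (N + 1) (hu.2.trans httN.ge)
    rcases Nat.eq_zero_or_pos i with rfl | hpos
    · refine hpiece k l δ hδ hc hH 0 0 h0 u ⟨hu0.le, hu.2⟩ fun k => ?_
      rw [htt0] at hui
      simpa [c] using hJy1 k u hui
    have hi' : i ∈ Finset.Icc 1 N := Finset.mem_Icc.2 ⟨hpos, by omega⟩
    rcases le_or_gt u (ss i) with hs | hs
    · simpa [hJy3 k i hi' u ⟨hui.1, hs⟩, hJy3 l i hi' u ⟨hui.1, hs⟩] using hnonneg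
    · refine hpiece k l δ hδ hc hH ⟨i, hi⟩ (ss i) (hss i hi') u ⟨hs.le, hu.2⟩ fun k => ?_
      simpa [c, hpos.ne'] using hJy2 k i hi' u ⟨hs, hui.2⟩
  refine Metric.uniformCauchySeqOn_iff.2 fun ε hε => ?_
  have hMpos : 0 < M := by linarith
  have hδ : 0 < ε / (4 * M) := by positivity
  obtain ⟨m₁, hm₁⟩ := Metric.cauchySeq_iff.1 hcρ.cauchySeq _ hδ
  obtain ⟨m₂, hm₂⟩ := Metric.uniformCauchySeqOn_iff.1 hHσ _ hδ
  refine ⟨max m₁ m₂, fun k hk l hl u hu => ?_⟩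
  have hc := hm₁ k (le_of_max_le_left hk) l (le_of_max_le_left hl)
  have hH := hm₂ (ρ k) ((le_of_max_le_right hk).trans (hρ.id_le k))
    (ρ l) ((le_of_max_le_right hl).trans (hρ.id_le l))
  simp only [dist_eq_norm] at hc hH ⊢
  refine (hmain _ _ _ hδ hc hH u hu).trans_lt ?_
  have : M * (3 * (ε / (4 * M))) = 3 / 4 * ε := by field_simp
  linarith
end
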